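/- (Correctness of the reduction from orthant satisfiability to menu validity.) Let d ≥ 1 and let u_1,…,u_d : [m]×[n] → ℝ be payoff functions. (a) If for each i ∈ [d] there exist pure action pairs (a,b) and (a',b') in [m]×[n] with u_i(a,b) ≤ 0 and u_i(a',b') ≥ 0, then there exists a CSP assignment Φ = (φ_1,…,φ_d) ∈ (Δ_{mn})^d with u_i(φ_i) = 0 for every i ∈ [d]. (b) For any CSP assignment Φ with u_i(φ_i) = 0 for all i ∈ [d], setting u_{O,i} := −u_i, the candidate menu C(Φ) is response-satisfiable if and only if for every y ∈ Δ_n there exists x ∈ Δ_m with u_i(x⊗y) ≥ 0 for all i ∈ [d] (i.e., the nonnegative orthant is response-satisfiable for the vector payoff (u_1,…,u_d)). -/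

import Mathlib

open scoped BigOperators

noncomputable section

/-- Linear extension of a payoff function to CSPs. -/
def lin {m n : ℕ} (u : Fin m × Fin n → ℝ) (φ : Fin m × Fin n → ℝ) : ℝ :=
  ∑ p : Fin m × Fin n, φ p * u p

/-- The product distribution `x ⊗ y`. -/
def prodCSP {m n : ℕ} (x : Fin m → ℝ) (y : Fin n → ℝ) : Fin m × Fin n → ℝ :=
  fun p => x p.1 * y p.2

/-- A set of CSPs is response-satisfiable. -/
def ResponseSatisfiable {m n : ℕ} (M : Set (Fin m × Fin n → ℝ)) : Prop :=
  ∀ y ∈ stdSimplex ℝ (Fin n), ∃ x ∈ stdSimplex ℝ (Fin m), prodCSP x y ∈ M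

/-- The candidate menu `C(Φ)` of a CSP assignment `Φ`. -/
def candidateMenu {m n d : ℕ} (uO : Fin d → Fin m × Fin n → ℝ)
    (Φ : Fin d → Fin m × Fin n → ℝ) : Set (Fin m × Fin n → ℝ) :=
  {φ ∈ stdSimplex ℝ (Fin m × Fin n) | ∀ i, lin (uO i) φ ≤ lin (uO i) (Φ i)}

lemma isLinearMap_lin {m n : ℕ} (u : Fin m × Fin n → ℝ) : IsLinearMap ℝ (lin u) where
  map_add φ ψ := by simp [lin, add_mul, Finset.sum_add_distrib]
  map_smul c φ := by simp [lin, mul_assoc, Finset.mul_sum]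

lemma lin_single {m n : ℕ} (u : Fin m × Fin n → ℝ) (p : Fin m × Fin n) :
    lin u (Pi.single p 1) = u p := by
  simp [lin, Pi.single_apply]

lemma lin_neg {m n : ℕ} (u φ : Fin m × Fin n → ℝ) : lin (-u) φ = -lin u φ := by
  simp [lin]

lemma exists_mem_stdSimplex_lin_eq_zero {m n : ℕ} (u : Fin m × Fin n → ℝ) {p q : Fin m × Fin n}
    (hp : u p ≤ 0) (hq : 0 ≤ u q) :
    ∃ φ ∈ stdSimplex ℝ (Fin m × Fin n), lin u φ = 0 :=
  ((convex_stdSimplex ℝ (Fin m × Fin n)).is_linear_image (isLinearMap_lin u)).ordConnected.out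
    ⟨_, single_mem_stdSimplex ℝ p, lin_single u p⟩
    ⟨_, single_mem_stdSimplex ℝ q, lin_single u q⟩ ⟨hp, hq⟩

lemma prodCSP_mem_stdSimplex {m n : ℕ} {x : Fin m → ℝ} {y : Fin n → ℝ}
    (hx : x ∈ stdSimplex ℝ (Fin m)) (hy : y ∈ stdSimplex ℝ (Fin n)) :
    prodCSP x y ∈ stdSimplex ℝ (Fin m × Fin n) := by
  refine ⟨fun p => mul_nonneg (hx.1 _) (hy.1 _), ?_⟩
  simp only [prodCSP, Fintype.sum_prod_type, ← Finset.mul_sum, hy.2, mul_one, hx.2]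

lemma mem_candidateMenu_neg {m n d : ℕ} {u Φ : Fin d → Fin m × Fin n → ℝ}
    (hΦ : ∀ i, lin (u i) (Φ i) = 0) {φ : Fin m × Fin n → ℝ}
    (hφ : φ ∈ stdSimplex ℝ (Fin m × Fin n)) :
    φ ∈ candidateMenu (fun i => -(u i)) Φ ↔ ∀ i, 0 ≤ lin (u i) φ := by
  simp [candidateMenu, hφ, lin_neg, hΦ]

/-- correctness of the reduction from orthant satisfiability to
menu validity: (a) if each `u_i` takes a nonpositive and a nonnegative value
on pure action pairs, there is a CSP assignment `Φ` with `u_i(φ_i) = 0` for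
all `i`; (b) for any such `Φ`, with `u_{O,i} := −u_i`, the candidate menu
`C(Φ)` is response-satisfiable iff the nonnegative orthant is
response-satisfiable for the vector payoff `(u_1,…,u_d)`. -/
theorem orthant_reduction {m n d : ℕ}
    (hm : 0 < m) (hn : 0 < n) (hd : 0 < d)
    (u : Fin d → Fin m × Fin n → ℝ) :
    ((∀ i, (∃ ab : Fin m × Fin n, u i ab ≤ 0) ∧ (∃ ab : Fin m × Fin n, 0 ≤ u i ab)) →
      ∃ Φ : Fin d → Fin m × Fin n → ℝ,
        (∀ i, Φ i ∈ stdSimplex ℝ (Fin m × Fin n)) ∧ ∀ i, lin (u i) (Φ i) = 0)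
    ∧ (∀ Φ : Fin d → Fin m × Fin n → ℝ,
        (∀ i, Φ i ∈ stdSimplex ℝ (Fin m × Fin n)) →
        (∀ i, lin (u i) (Φ i) = 0) →
        (ResponseSatisfiable (candidateMenu (fun i => -(u i)) Φ) ↔
          ∀ y ∈ stdSimplex ℝ (Fin n), ∃ x ∈ stdSimplex ℝ (Fin m),
            ∀ i, 0 ≤ lin (u i) (prodCSP x y))) := by
  refine ⟨fun h => ?_, fun Φ _ hΦ => ?_⟩
  · have key (i) : ∃ φ ∈ stdSimplex ℝ (Fin m × Fin n), lin (u i) φ = 0 := by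
      obtain ⟨⟨p, hp⟩, q, hq⟩ := h i
      exact exists_mem_stdSimplex_lin_eq_zero (u i) hp hq
    choose Φ hmem hzero using key
    exact ⟨Φ, hmem, hzero⟩
  · exact forall₂_congr fun y hy => exists_congr fun x => and_congr_right fun hx =>
      mem_candidateMenu_neg hΦ (prodCSP_mem_stdSimplex hx hy)
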